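/- Let ζ in ℓ²(ℕ,ℂ) belong to the domain of the number operator N, and let γ : ℝ⁴ → ℝ be (Fréchet) differentiable. Then the map x ↦ V(γ(x))ζ from ℝ⁴ to ℓ²(ℕ,ℂ) is Fréchet differentiable, with derivative at x given by h ↦ i·(Dγ(x)h) · V(γ(x))(Nζ), where Dγ(x) is the derivative of γ at x. -/

import Mathlib

open Filter Topology

/-- Dominated convergence in `ℓ²`. -/
theorem tendsto_lp_two_of_dominated {ι α : Type*} {l : Filter α}
    {F : α → lp (fun _ : ι => ℂ) 2} {f : lp (fun _ : ι => ℂ) 2} {b : ι → ℂ}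
    (hb : Memℓp b 2) (hF : ∀ i, Tendsto (fun a => F a i) l (𝓝 (f i)))
    (hFb : ∀ᶠ a in l, ∀ i, ‖F a i - f i‖ ≤ ‖b i‖) :
    Tendsto F l (𝓝 f) := by
  have two_pos : 0 < (2 : ENNReal).toReal := by norm_num
  rw [tendsto_iff_norm_sub_tendsto_zero]
  have hsum : Tendsto (fun a => ∑' i, ‖F a i - f i‖ ^ (2 : ENNReal).toReal) l
      (𝓝 (∑' _ : ι, (0 : ℝ))) := by
    refine tendsto_tsum_of_dominated_convergence (hb.summable two_pos) (fun i => ?_) ?_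
    · simpa using ((tendsto_iff_norm_sub_tendsto_zero.1 (hF i)).pow 2)
    · filter_upwards [hFb] with a ha i
      rw [Real.norm_of_nonneg (by positivity)]
      exact Real.rpow_le_rpow (norm_nonneg _) (ha i) two_pos.le
  have hsqrt := (Real.continuous_sqrt.tendsto _).comp hsum
  simp only [tsum_zero, Real.sqrt_zero] at hsqrt
  refine hsqrt.congr fun a => ?_
  have h := lp.norm_rpow_eq_tsum two_pos (F a - f)
  simp only [lp.coeFn_sub, Pi.sub_apply] at h
  rw [Function.comp_apply, ← h, ENNReal.toReal_ofNat, Real.rpow_ofNat]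
  exact Real.sqrt_sq (norm_nonneg _)

theorem norm_exp_I_mul_ofReal_mul_natCast (t : ℝ) (n : ℕ) :
    ‖Complex.exp (Complex.I * t * n)‖ = 1 := by
  simpa [mul_assoc] using Complex.norm_exp_I_mul_ofReal (t * n)

/-- The diagonal unitary `V(t)` on `ℓ²(ℕ,ℂ)`, with entries `exp(itn)`. -/
noncomputable def diagonalUnitary (t : ℝ) (ζ : lp (fun _ : ℕ => ℂ) 2) :
    lp (fun _ : ℕ => ℂ) 2 :=
  ⟨fun n => Complex.exp (Complex.I * t * n) * ζ n,
    (lp.memℓp ζ).mono' fun n => by simp [norm_exp_I_mul_ofReal_mul_natCast]⟩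

theorem norm_exp_sub_exp_le (t s : ℝ) (n : ℕ) :
    ‖Complex.exp (Complex.I * ((t + s : ℝ) : ℂ) * n) - Complex.exp (Complex.I * t * n)‖
      ≤ |s| * n := by
  have h : Complex.exp (Complex.I * ((t + s : ℝ) : ℂ) * n) - Complex.exp (Complex.I * t * n)
      = Complex.exp (Complex.I * t * n) * (Complex.exp (Complex.I * ((s * n : ℝ) : ℂ)) - 1) := by
    rw [mul_sub, ← Complex.exp_add, mul_one]
    push_cast
    ring_nf
  rw [h, norm_mul, norm_exp_I_mul_ofReal_mul_natCast, one_mul]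
  simpa [abs_mul] using Real.norm_exp_I_mul_ofReal_sub_one_le (x := s * n)

/-- On the domain of the number operator, `t ↦ V(t)ζ` has derivative `i V(t)(Nζ)`. -/
theorem hasDerivAt_diagonalUnitary (ζ Nζ : lp (fun _ : ℕ => ℂ) 2)
    (hN : ∀ n : ℕ, Nζ n = n * ζ n) (t : ℝ) :
    HasDerivAt (fun t => diagonalUnitary t ζ) (Complex.I • diagonalUnitary t Nζ) t := by
  rw [hasDerivAt_iff_tendsto_slope_zero]
  refine tendsto_lp_two_of_dominated (lp.memℓp ((2 : ℂ) • Nζ)) (fun n => ?_) ?_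
  · have h : HasDerivAt (fun t : ℝ => Complex.exp (Complex.I * t * n) * ζ n)
        (Complex.I * (Complex.exp (Complex.I * t * n) * Nζ n)) t := by
      have h₁ : HasDerivAt (fun t : ℝ => Complex.I * (t : ℂ) * n) (Complex.I * 1 * n) t :=
        (Complex.ofRealCLM.hasDerivAt.const_mul Complex.I).mul_const (n : ℂ)
      refine (h₁.cexp.mul_const (ζ n)).congr_deriv ?_
      rw [hN]
      ring
    have h' := hasDerivAt_iff_tendsto_slope_zero.1 h
    exact h'
  · filter_upwards [self_mem_nhdsWithin] with s hs n
    have hs' : 0 < |s| := abs_pos.2 hs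
    change ‖s⁻¹ • (Complex.exp (Complex.I * ((t + s : ℝ) : ℂ) * n) * ζ n
      - Complex.exp (Complex.I * t * n) * ζ n)
      - Complex.I * (Complex.exp (Complex.I * t * n) * Nζ n)‖ ≤ ‖2 * Nζ n‖
    have hslope : ‖s⁻¹ • (Complex.exp (Complex.I * ((t + s : ℝ) : ℂ) * n) * ζ n
        - Complex.exp (Complex.I * t * n) * ζ n)‖ ≤ ‖Nζ n‖ := by
      rw [← sub_mul, norm_smul, norm_mul, hN, norm_mul, norm_inv, Real.norm_eq_abs,
        Complex.norm_natCast, ← mul_assoc]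
      gcongr
      rw [inv_mul_le_iff₀ hs']
      exact norm_exp_sub_exp_le t s n
    refine (norm_sub_le _ _).trans ?_
    simp only [norm_mul, Complex.norm_I, norm_exp_I_mul_ofReal_mul_natCast, Complex.norm_ofNat]
    linarith

/-- If `ζ ∈ ℓ²(ℕ,ℂ)` lies in the domain of the number operator `N` (i.e. `(n·ζₙ)ₙ ∈ ℓ²`)
and `γ : ℝ⁴ → ℝ` is differentiable, then `x ↦ V(γ(x))ζ`, where `(V(γ)ζ)ₙ = exp(iγn)ζₙ`,
is Fréchet differentiable from `ℝ⁴` to `ℓ²(ℕ,ℂ)` with derivative at `x` given by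
`h ↦ i·(Dγ(x)h) · V(γ(x))(Nζ)`. -/
theorem diagonal_unitary_field_frechet_differentiable
    (ζ : lp (fun _ : ℕ => ℂ) 2)
    (hζ : Memℓp (fun n : ℕ => (n : ℂ) * ζ n) 2)
    (γ : (Fin 4 → ℝ) → ℝ) (hγ : Differentiable ℝ γ) :
    ∃ G NG : (Fin 4 → ℝ) → lp (fun _ : ℕ => ℂ) 2,
      (∀ (x : Fin 4 → ℝ) (n : ℕ), G x n = Complex.exp (Complex.I * γ x * n) * ζ n) ∧
      (∀ (x : Fin 4 → ℝ) (n : ℕ),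
        NG x n = Complex.exp (Complex.I * γ x * n) * ((n : ℂ) * ζ n)) ∧
      ∀ x : Fin 4 → ℝ,
        HasFDerivAt G ((fderiv ℝ γ x).smulRight (Complex.I • NG x)) x := by
  let Nζ : lp (fun _ : ℕ => ℂ) 2 := ⟨fun n => n * ζ n, hζ⟩
  exact ⟨fun x => diagonalUnitary (γ x) ζ, fun x => diagonalUnitary (γ x) Nζ,
    fun _ _ => rfl, fun _ _ => rfl, fun x =>
      ((hasDerivAt_diagonalUnitary ζ Nζ (fun _ => rfl) (γ x)).hasFDerivAt.comp x
        (hγ x).hasFDerivAt).congr_fderiv (by ext; simp)⟩
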